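/- Suppose L_S is twice continuously differentiable, its gradient is L-Lipschitz on W × Φ, (w,φ) ↦ ∇²_w L_S(w,φ) is ρ-Lipschitz in operator norm, L_S(·,φ) is μ-strongly convex in w for every φ with 0 < μ < L, and α = μ/L². Then for every N ≥ 1 and all (w₁,φ₁), (w₂,φ₂) ∈ W × Φ the ordered products satisfy (in operator norm): ‖∏_{m=0}^{N−1}(I − α∇²_w L_S(w_m(w₁,φ₁),φ₁)) − ∏_{m=0}^{N−1}(I − α∇²_w L_S(w_m(w₂,φ₂),φ₂))‖ ≤ (2ρ/μ)(1 − μ²/L²)^{N−1} ‖w₁ − w₂‖ + αρ(2L/μ + 1) N (1 − μ²/L²)^{N−1} ‖φ₁ − φ₂‖, where each product is ordered with the m = 0 factor leftmost. -/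

import Mathlib

noncomputable section

open scoped RealInnerProductSpace

abbrev Wsp (p : ℕ) := EuclideanSpace ℝ (Fin p)

/-- Partial gradient in the first block of variables. -/
def gradW {p q : ℕ} (f : Wsp p × Wsp q → ℝ) (w : Wsp p) (φ : Wsp q) : Wsp p :=
  gradient (fun u => f (u, φ)) w

/-- Partial gradient in the second block of variables. -/
def gradPhi {p q : ℕ} (f : Wsp p × Wsp q → ℝ) (w : Wsp p) (φ : Wsp q) : Wsp q :=
  gradient (fun ψ => f (w, ψ)) φ

/-- Inner-loop gradient descent iterates. -/
def innerIter {p q : ℕ} (f : Wsp p × Wsp q → ℝ) (α : ℝ) : ℕ → Wsp p → Wsp q → Wsp p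
  | 0, w, _ => w
  | (m+1), w, φ => innerIter f α m w φ - α • gradW f (innerIter f α m w φ) φ

/-- Hessian in `w` of `f(·,φ)` at `w`, as a continuous linear map. -/
def hessW {p q : ℕ} (f : Wsp p × Wsp q → ℝ) (w : Wsp p) (φ : Wsp q) : Wsp p →L[ℝ] Wsp p :=
  fderiv ℝ (fun u => gradW f u φ) w

/-- Mixed second derivative `∇_φ∇_w f (w,φ)`, viewed as a linear map `W → Φ`. -/
def crossD {p q : ℕ} (f : Wsp p × Wsp q → ℝ) (w : Wsp p) (φ : Wsp q) : Wsp p →L[ℝ] Wsp q :=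
  ContinuousLinearMap.adjoint (fderiv ℝ (fun ψ => gradW f w ψ) φ)

/-- Ordered product `A a * A (a+1) * ⋯ * A (b-1)` (factor `A a` leftmost, i.e. applied last). -/
def prodIco {p : ℕ} (A : ℕ → (Wsp p →L[ℝ] Wsp p)) (a b : ℕ) : Wsp p →L[ℝ] Wsp p :=
  ((List.range (b - a)).map (fun k => A (a + k))).prod

/-- `f(·,φ)` is `μc`-strongly convex in `w`, for every `φ`. -/
def StrongConvexIn {p q : ℕ} (μc : ℝ) (f : Wsp p × Wsp q → ℝ) : Prop :=
  ∀ (w w' : Wsp p) (φ : Wsp q),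
    f (w', φ) ≥ f (w, φ) + ⟪w' - w, gradW f w φ⟫ + μc / 2 * ‖w - w'‖ ^ 2

/-- The (full) gradient of `f` is `L`-Lipschitz on `W × Φ` (Euclidean norms). -/
def GradLip {p q : ℕ} (L : ℝ) (f : Wsp p × Wsp q → ℝ) : Prop :=
  ∀ (w₁ w₂ : Wsp p) (φ₁ φ₂ : Wsp q),
    Real.sqrt (‖gradW f w₁ φ₁ - gradW f w₂ φ₂‖ ^ 2 + ‖gradPhi f w₁ φ₁ - gradPhi f w₂ φ₂‖ ^ 2)
      ≤ L * Real.sqrt (‖w₁ - w₂‖ ^ 2 + ‖φ₁ - φ₂‖ ^ 2)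

/-- `f` is `M`-Lipschitz on `W × Φ` (Euclidean norms). -/
def FunLip {p q : ℕ} (M : ℝ) (f : Wsp p × Wsp q → ℝ) : Prop :=
  ∀ (w₁ w₂ : Wsp p) (φ₁ φ₂ : Wsp q),
    |f (w₁, φ₁) - f (w₂, φ₂)| ≤ M * Real.sqrt (‖w₁ - w₂‖ ^ 2 + ‖φ₁ - φ₂‖ ^ 2)

/-- `(w,φ) ↦ ∇²_w f(w,φ)` is `ρ`-Lipschitz in operator norm. -/
def HessLip {p q : ℕ} (ρ : ℝ) (f : Wsp p × Wsp q → ℝ) : Prop :=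
  ∀ (w₁ w₂ : Wsp p) (φ₁ φ₂ : Wsp q),
    ‖hessW f w₁ φ₁ - hessW f w₂ φ₂‖ ≤ ρ * Real.sqrt (‖w₁ - w₂‖ ^ 2 + ‖φ₁ - φ₂‖ ^ 2)

/-- `(w,φ) ↦ ∇_φ∇_w f(w,φ)` is `τ`-Lipschitz in operator norm. -/
def CrossLip {p q : ℕ} (τ : ℝ) (f : Wsp p × Wsp q → ℝ) : Prop :=
  ∀ (w₁ w₂ : Wsp p) (φ₁ φ₂ : Wsp q),
    ‖crossD f w₁ φ₁ - crossD f w₂ φ₂‖ ≤ τ * Real.sqrt (‖w₁ - w₂‖ ^ 2 + ‖φ₁ - φ₂‖ ^ 2)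

theorem aux_sym_norm {E : Type*} [NormedAddCommGroup E] [InnerProductSpace ℝ E]
    (T : E →L[ℝ] E) (κ : ℝ) (hκ : 0 < κ)
    (hs : ∀ v w, inner ℝ (T v) w = inner ℝ (T w) v)
    (hq : ∀ v, |inner ℝ (T v) v| ≤ κ * ‖v‖ ^ 2) : ‖T‖ ≤ κ := by
  refine T.opNorm_le_bound hκ.le fun v => ?_
  have h1 := (abs_le.1 (hq (v + κ⁻¹ • T v))).2
  have h2 := (abs_le.1 (hq (v - κ⁻¹ • T v))).1
  have h3 := parallelogram_law_with_norm ℝ v (κ⁻¹ • T v)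
  have h4 := hs v (T v)
  have h5 : inner ℝ (T v) (T v) = ‖T v‖ ^ 2 := real_inner_self_eq_norm_sq _
  have h6 : ‖κ⁻¹ • T v‖ = κ⁻¹ * ‖T v‖ := by
    rw [norm_smul, Real.norm_of_nonneg (inv_nonneg.2 hκ.le)]
  simp only [map_add, map_sub, map_smul, inner_add_left, inner_add_right, inner_sub_left,
    inner_sub_right, inner_smul_left, inner_smul_right, RCLike.conj_to_real] at h1 h2
  rw [← h4, h5] at h1 h2
  rw [h6] at h3
  have h7 : 4 * (κ⁻¹ * ‖T v‖ ^ 2) ≤ 2 * κ * (‖v‖ ^ 2 + (κ⁻¹ * ‖T v‖) ^ 2) := by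
    have : κ * (‖v + κ⁻¹ • T v‖ ^ 2 + ‖v - κ⁻¹ • T v‖ ^ 2)
        = 2 * κ * (‖v‖ ^ 2 + (κ⁻¹ * ‖T v‖) ^ 2) := by
      linear_combination κ * h3
    linarith
  have h8 : ‖T v‖ ^ 2 ≤ (κ * ‖v‖) ^ 2 := by
    have e : 2 * κ * (‖v‖ ^ 2 + (κ⁻¹ * ‖T v‖) ^ 2) = 2 * κ * ‖v‖ ^ 2 + 2 * (κ⁻¹ * ‖T v‖ ^ 2) := by
      field_simp
    rw [e] at h7
    have h9 : κ⁻¹ * ‖T v‖ ^ 2 ≤ κ * ‖v‖ ^ 2 := by linarith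
    rw [inv_mul_le_iff₀ hκ] at h9
    linarith
  exact le_of_sq_le_sq h8 (by positivity)

theorem aux_slice {p q : ℕ} {f : Wsp p × Wsp q → ℝ} (hf : ContDiff ℝ 2 f) (φ : Wsp q) :
    ContDiff ℝ 2 (fun u => f (u, φ)) := by fun_prop

def auxDual (p : ℕ) : (StrongDual ℝ (Wsp p)) →L[ℝ] Wsp p :=
  LinearMap.mkContinuous
    { toFun := fun x => (InnerProductSpace.toDual ℝ (Wsp p)).symm x
      map_add' := fun x y => map_add _ x y
      map_smul' := fun c x => by simp } 1 (fun x => by simp)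

theorem aux_hasF {p q : ℕ} {f : Wsp p × Wsp q → ℝ} (hf : ContDiff ℝ 2 f) (w : Wsp p) (φ : Wsp q) :
    HasFDerivAt (fun u => gradW f u φ) ((auxDual p) ∘L (fderiv ℝ (fderiv ℝ (fun u => f (u, φ))) w)) w := by
  have hd : DifferentiableAt ℝ (fderiv ℝ (fun u => f (u, φ))) w :=
    (((aux_slice hf φ).fderiv_right (m := 1) (by norm_num)).differentiable (by norm_num)) w
  exact (auxDual p).hasFDerivAt.comp w hd.hasFDerivAt

theorem aux_hasF2 {p q : ℕ} {f : Wsp p × Wsp q → ℝ} (hf : ContDiff ℝ 2 f) (w : Wsp p) (φ : Wsp q) :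
    HasFDerivAt (fun u => gradW f u φ) (hessW f w φ) w :=
  (aux_hasF hf w φ).differentiableAt.hasFDerivAt

theorem aux_symm {p q : ℕ} {f : Wsp p × Wsp q → ℝ} (hf : ContDiff ℝ 2 f) (w : Wsp p) (φ : Wsp q)
    (u v : Wsp p) : inner ℝ (hessW f w φ u) v = inner ℝ (hessW f w φ v) u := by
  have h := (aux_hasF hf w φ).fderiv
  have hs : IsSymmSndFDerivAt ℝ (fun u => f (u, φ)) w :=
    (aux_slice hf φ).contDiffAt.isSymmSndFDerivAt (by simp)
  unfold hessW
  rw [h]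
  have key : ∀ a b : Wsp p, inner ℝ (((auxDual p) ∘L (fderiv ℝ (fderiv ℝ (fun u => f (u, φ))) w)) a) b
      = fderiv ℝ (fderiv ℝ (fun u => f (u, φ))) w a b := fun a b =>
    InnerProductSpace.toDual_symm_apply
  rw [key, key]
  exact hs u v

theorem aux_lip {p q : ℕ} {f : Wsp p × Wsp q → ℝ} {L : ℝ} (h : GradLip L f)
    (w₁ w₂ : Wsp p) (φ₁ φ₂ : Wsp q) :
    ‖gradW f w₁ φ₁ - gradW f w₂ φ₂‖ ≤ L * Real.sqrt (‖w₁ - w₂‖ ^ 2 + ‖φ₁ - φ₂‖ ^ 2) :=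
  (Real.le_sqrt_of_sq_le (by nlinarith [sq_nonneg ‖gradPhi f w₁ φ₁ - gradPhi f w₂ φ₂‖])).trans
    (h w₁ w₂ φ₁ φ₂)

theorem aux_hess_le {p q : ℕ} {f : Wsp p × Wsp q → ℝ} {L : ℝ} (hL : 0 ≤ L) (h : GradLip L f)
    (w : Wsp p) (φ : Wsp q) : ‖hessW f w φ‖ ≤ L := by
  refine norm_fderiv_le_of_lip' ℝ hL (Filter.Eventually.of_forall fun x => ?_)
  simpa using aux_lip h x w φ φ

theorem aux_mono {p q : ℕ} {f : Wsp p × Wsp q → ℝ} {μ : ℝ} (h : StrongConvexIn μ f)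
    (w w' : Wsp p) (φ : Wsp q) :
    μ * ‖w' - w‖ ^ 2 ≤ inner ℝ (gradW f w' φ - gradW f w φ) (w' - w) := by
  have h1 := h w w' φ
  have h2 := h w' w φ
  rw [norm_sub_rev w w'] at h1
  rw [← neg_sub w' w, inner_neg_left] at h2
  rw [inner_sub_left, real_inner_comm, real_inner_comm _ (gradW f w φ)]
  linarith

theorem aux_hess_ge {p q : ℕ} {f : Wsp p × Wsp q → ℝ} (hf : ContDiff ℝ 2 f) {μ : ℝ}
    (h : StrongConvexIn μ f) (w : Wsp p) (φ : Wsp q) (v : Wsp p) :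
    μ * ‖v‖ ^ 2 ≤ inner ℝ (hessW f w φ v) v := by
  have hl : HasDerivAt (fun t : ℝ => w + t • v) v 0 := by
    simpa using ((hasDerivAt_id (0 : ℝ)).smul_const v).const_add w
  have hF : HasFDerivAt (fun u => gradW f u φ) (hessW f w φ) (w + (0 : ℝ) • v) := by
    simpa using aux_hasF2 hf w φ
  have hg : HasDerivAt (fun t : ℝ => gradW f (w + t • v) φ) (hessW f w φ v) 0 :=
    hF.comp_hasDerivAt (0 : ℝ) hl
  have hs := hg.tendsto_slope_zero
  have hi := hs.inner (tendsto_const_nhds (x := v)) (𝕜 := ℝ)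
  refine ge_of_tendsto hi ?_
  filter_upwards [self_mem_nhdsWithin] with t ht
  have ht : t ≠ 0 := ht
  have hm := aux_mono h w (w + t • v) φ
  simp only [zero_add, zero_smul, add_zero, inner_smul_left, RCLike.conj_to_real]
  simp only [add_sub_cancel_left, norm_smul, inner_smul_right, mul_pow, Real.norm_eq_abs, sq_abs] at hm
  have ht2 : 0 < t ^ 2 := by positivity
  refine le_of_mul_le_mul_left ?_ ht2
  have e : t ^ 2 * (t⁻¹ * inner ℝ (gradW f (w + t • v) φ - gradW f w φ) v)
    = t * inner ℝ (gradW f (w + t • v) φ - gradW f w φ) v := by field_simp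
  rw [e]
  linarith

theorem aux_factor {p q : ℕ} {f : Wsp p × Wsp q → ℝ} (hf : ContDiff ℝ 2 f) {L μ α : ℝ}
    (hLip : GradLip L f) (hSC : StrongConvexIn μ f) (hμ : 0 < μ) (hμL : μ < L)
    (hα0 : 0 < α) (hαL : α * L ≤ 1) (w : Wsp p) (φ : Wsp q) :
    ‖1 - α • hessW f w φ‖ ≤ 1 - α * μ := by
  have hk : 0 < 1 - α * μ := by nlinarith
  refine aux_sym_norm _ _ hk (fun u v => ?_) (fun v => ?_)
  · simp [inner_sub_left, inner_smul_left, aux_symm hf w φ u v, real_inner_comm u v]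
  · have h1 := aux_hess_ge hf hSC w φ v
    have h2 : inner ℝ (hessW f w φ v) v ≤ L * ‖v‖ ^ 2 := by
      have a := real_inner_le_norm (hessW f w φ v) v
      have b := (hessW f w φ).le_of_opNorm_le (aux_hess_le (by linarith) hLip w φ) v
      nlinarith [norm_nonneg v]
    have e : inner ℝ ((1 - α • hessW f w φ) v) v = ‖v‖ ^ 2 - α * inner ℝ (hessW f w φ v) v := by
      simp [inner_sub_left, inner_smul_left]
    rw [e, abs_of_nonneg]
    · nlinarith
    · nlinarith [sq_nonneg ‖v‖]

theorem aux_sqrt (a b : ℝ) (ha : 0 ≤ a) (hb : 0 ≤ b) : Real.sqrt (a ^ 2 + b ^ 2) ≤ a + b := by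
  rw [Real.sqrt_le_left (by positivity)]
  nlinarith

theorem aux_step {p q : ℕ} {f : Wsp p × Wsp q → ℝ} (hf : ContDiff ℝ 2 f) {L μ α : ℝ}
    (hLip : GradLip L f) (hSC : StrongConvexIn μ f) (hμ : 0 < μ) (hμL : μ < L)
    (hα0 : 0 < α) (hαL : α * L ≤ 1) (w₁ w₂ : Wsp p) (φ₁ φ₂ : Wsp q) :
    ‖(w₁ - α • gradW f w₁ φ₁) - (w₂ - α • gradW f w₂ φ₂)‖
      ≤ (1 - α * μ) * ‖w₁ - w₂‖ + α * L * ‖φ₁ - φ₂‖ := by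
  have hd : ∀ u : Wsp p, HasFDerivAt (fun u => u - α • gradW f u φ₁) (1 - α • hessW f u φ₁) u :=
    fun u => (hasFDerivAt_id u).sub ((aux_hasF2 hf u φ₁).const_smul α)
  have h1 : ‖(w₁ - α • gradW f w₁ φ₁) - (w₂ - α • gradW f w₂ φ₁)‖ ≤ (1 - α * μ) * ‖w₁ - w₂‖ :=
    Convex.norm_image_sub_le_of_norm_fderiv_le (𝕜 := ℝ) (f := fun u => u - α • gradW f u φ₁)
      (s := Set.univ) (fun u _ => (hd u).differentiableAt)
      (fun u _ => by
        rw [(hd u).fderiv]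
        exact aux_factor hf hLip hSC hμ hμL hα0 hαL u φ₁) convex_univ (Set.mem_univ _) (Set.mem_univ _)
  have h2 : ‖gradW f w₂ φ₂ - gradW f w₂ φ₁‖ ≤ L * ‖φ₁ - φ₂‖ := by
    have := aux_lip hLip w₂ w₂ φ₂ φ₁
    rw [norm_sub_rev φ₁ φ₂]
    simpa using this
  have e : (w₁ - α • gradW f w₁ φ₁) - (w₂ - α • gradW f w₂ φ₂)
      = ((w₁ - α • gradW f w₁ φ₁) - (w₂ - α • gradW f w₂ φ₁))
        + α • (gradW f w₂ φ₂ - gradW f w₂ φ₁) := by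
    rw [smul_sub]; abel
  rw [e]
  refine (norm_add_le _ _).trans (add_le_add h1 ?_)
  rw [norm_smul, Real.norm_of_nonneg hα0.le, mul_assoc]
  gcongr

theorem aux_iter {p q : ℕ} {f : Wsp p × Wsp q → ℝ} (hf : ContDiff ℝ 2 f) {L μ α : ℝ}
    (hLip : GradLip L f) (hSC : StrongConvexIn μ f) (hμ : 0 < μ) (hμL : μ < L)
    (hα0 : 0 < α) (hαL : α * L ≤ 1) (w₁ w₂ : Wsp p) (φ₁ φ₂ : Wsp q) (m : ℕ) :
    ‖innerIter f α m w₁ φ₁ - innerIter f α m w₂ φ₂‖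
      ≤ (1 - α * μ) ^ m * ‖w₁ - w₂‖ + L / μ * ‖φ₁ - φ₂‖ := by
  have hk : 0 < 1 - α * μ := by nlinarith
  have hL : 0 < L := by linarith
  induction m with
  | zero =>
    simp only [innerIter, pow_zero, one_mul]
    have : 0 ≤ L / μ * ‖φ₁ - φ₂‖ := by positivity
    linarith
  | succ m ih =>
    simp only [innerIter]
    refine (aux_step hf hLip hSC hμ hμL hα0 hαL _ _ φ₁ φ₂).trans ?_
    have := mul_le_mul_of_nonneg_left ih hk.le
    have e : (1 - α * μ) * ((1 - α * μ) ^ m * ‖w₁ - w₂‖ + L / μ * ‖φ₁ - φ₂‖) + α * L * ‖φ₁ - φ₂‖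
        = (1 - α * μ) ^ (m + 1) * ‖w₁ - w₂‖ + L / μ * ‖φ₁ - φ₂‖ := by
      field_simp
      ring
    linarith

theorem aux_prod_succ {p : ℕ} (A : ℕ → (Wsp p →L[ℝ] Wsp p)) (n : ℕ) :
    prodIco A 0 (n + 1) = prodIco A 0 n * A n := by
  simp [prodIco, List.range_succ]

theorem aux_prod_norm {p : ℕ} (A : ℕ → (Wsp p →L[ℝ] Wsp p)) {κ : ℝ} (hκ : 0 ≤ κ)
    (hA : ∀ m, ‖A m‖ ≤ κ) (n : ℕ) : ‖prodIco A 0 n‖ ≤ κ ^ n := by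
  induction n with
  | zero =>
    simp only [prodIco, Nat.sub_self, List.range_zero, List.map_nil, List.prod_nil, pow_zero]
    exact (ContinuousLinearMap.norm_id_le (𝕜 := ℝ) (E := Wsp p))
  | succ n ih =>
    rw [aux_prod_succ, pow_succ]
    exact (norm_mul_le _ _).trans (mul_le_mul ih (hA n) (norm_nonneg _) (by positivity))

theorem aux_prod_diff {p : ℕ} (A B : ℕ → (Wsp p →L[ℝ] Wsp p)) {κ : ℝ} (hκ : 0 ≤ κ)
    (hA : ∀ m, ‖A m‖ ≤ κ) (hB : ∀ m, ‖B m‖ ≤ κ) (δ : ℕ → ℝ) (hδ : ∀ m, ‖A m - B m‖ ≤ δ m) (n : ℕ) :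
    κ * ‖prodIco A 0 n - prodIco B 0 n‖ ≤ κ ^ n * ∑ i ∈ Finset.range n, δ i := by
  induction n with
  | zero => simp [prodIco]
  | succ n ih =>
    have e : prodIco A 0 (n + 1) - prodIco B 0 (n + 1)
        = (prodIco A 0 n - prodIco B 0 n) * A n + prodIco B 0 n * (A n - B n) := by
      rw [aux_prod_succ, aux_prod_succ, sub_mul, mul_sub]; abel
    have h1 : ‖prodIco A 0 (n + 1) - prodIco B 0 (n + 1)‖
        ≤ ‖prodIco A 0 n - prodIco B 0 n‖ * κ + κ ^ n * δ n := by
      rw [e]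
      refine (norm_add_le _ _).trans (add_le_add ?_ ?_)
      · exact (norm_mul_le _ _).trans (mul_le_mul_of_nonneg_left (hA n) (norm_nonneg _))
      · exact (norm_mul_le _ _).trans
          (mul_le_mul (aux_prod_norm B hκ hB n) (hδ n) (norm_nonneg _) (by positivity))
    have h2 := mul_le_mul_of_nonneg_left h1 hκ
    have h3 := mul_le_mul_of_nonneg_left ih hκ
    rw [Finset.sum_range_succ, pow_succ]
    nlinarith

/-- Lipschitz bound on the ordered product
`∏_{m=0}^{N-1}(I - α∇²_w L_S(w_m,φ))` under a strongly-convex inner loop with `α = μ/L²`. -/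
theorem anil_product_lipschitz_sc (p q : ℕ) (LS : Wsp p × Wsp q → ℝ)
    (hLS : ContDiff ℝ 2 LS) (L ρ μc α : ℝ)
    (hLip : GradLip L LS) (hHess : HessLip ρ LS)
    (hSC : StrongConvexIn μc LS) (hμ : 0 < μc) (hμL : μc < L) (hα : α = μc / L ^ 2) :
    ∀ (N : ℕ), 1 ≤ N → ∀ (w₁ w₂ : Wsp p) (φ₁ φ₂ : Wsp q),
      ‖prodIco (fun m => 1 - α • hessW LS (innerIter LS α m w₁ φ₁) φ₁) 0 N
          - prodIco (fun m => 1 - α • hessW LS (innerIter LS α m w₂ φ₂) φ₂) 0 N‖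
        ≤ (2 * ρ / μc) * (1 - μc ^ 2 / L ^ 2) ^ (N - 1) * ‖w₁ - w₂‖
          + α * ρ * (2 * L / μc + 1) * N * (1 - μc ^ 2 / L ^ 2) ^ (N - 1) * ‖φ₁ - φ₂‖ := by
  intro N hN w₁ w₂ φ₁ φ₂
  have hL : 0 < L := by linarith
  have hα0 : 0 < α := by rw [hα]; positivity
  have hαL : α * L ≤ 1 := by
    rw [hα]
    have : μc / L ^ 2 * L = μc / L := by field_simp
    rw [this, div_le_one hL]
    exact hμL.le
  have hκe : 1 - μc ^ 2 / L ^ 2 = 1 - α * μc := by rw [hα]; ring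
  rw [hκe]
  have hk : 0 < 1 - α * μc := by nlinarith
  rcases lt_or_ge ρ 0 with hρ | hρ
  · have h := (norm_nonneg _).trans (hHess w₁ w₂ φ₁ φ₂)
    have hs : Real.sqrt (‖w₁ - w₂‖ ^ 2 + ‖φ₁ - φ₂‖ ^ 2) ≤ 0 := by
      by_contra hc
      push Not at hc
      nlinarith
    have hs' := Real.sqrt_eq_zero'.1 (le_antisymm hs (Real.sqrt_nonneg _))
    have hw : ‖w₁ - w₂‖ = 0 := by nlinarith [sq_nonneg ‖w₁ - w₂‖, sq_nonneg ‖φ₁ - φ₂‖]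
    have hφ : ‖φ₁ - φ₂‖ = 0 := by nlinarith [sq_nonneg ‖w₁ - w₂‖, sq_nonneg ‖φ₁ - φ₂‖]
    have hw' := sub_eq_zero.1 (norm_eq_zero.1 hw)
    have hφ' := sub_eq_zero.1 (norm_eq_zero.1 hφ)
    subst hw' hφ'
    simp
  have hδ : ∀ m, ‖(1 - α • hessW LS (innerIter LS α m w₁ φ₁) φ₁)
      - (1 - α • hessW LS (innerIter LS α m w₂ φ₂) φ₂)‖
      ≤ α * ρ * ‖w₁ - w₂‖ * (1 - α * μc) ^ m + α * ρ * (L / μc + 1) * ‖φ₁ - φ₂‖ := by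
    intro m
    have h1 := hHess (innerIter LS α m w₁ φ₁) (innerIter LS α m w₂ φ₂) φ₁ φ₂
    have h2 := aux_sqrt _ _ (norm_nonneg (innerIter LS α m w₁ φ₁ - innerIter LS α m w₂ φ₂))
      (norm_nonneg (φ₁ - φ₂))
    have h3 := aux_iter hLS hLip hSC hμ hμL hα0 hαL w₁ w₂ φ₁ φ₂ m
    have h4 := h1.trans (mul_le_mul_of_nonneg_left (h2.trans (add_le_add_left h3 _)) hρ)
    have e : (1 - α • hessW LS (innerIter LS α m w₁ φ₁) φ₁)
      - (1 - α • hessW LS (innerIter LS α m w₂ φ₂) φ₂)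
      = -(α • (hessW LS (innerIter LS α m w₁ φ₁) φ₁ - hessW LS (innerIter LS α m w₂ φ₂) φ₂)) := by
      rw [smul_sub]; abel
    rw [e, norm_neg, norm_smul, Real.norm_of_nonneg hα0.le]
    refine (mul_le_mul_of_nonneg_left h4 hα0.le).trans (le_of_eq ?_)
    ring
  have hmain := aux_prod_diff _ _ hk.le
    (fun m => aux_factor hLS hLip hSC hμ hμL hα0 hαL (innerIter LS α m w₁ φ₁) φ₁)
    (fun m => aux_factor hLS hLip hSC hμ hμL hα0 hαL (innerIter LS α m w₂ φ₂) φ₂) _ hδ N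
  obtain ⟨n, rfl⟩ : ∃ n, N = n + 1 := ⟨N - 1, by omega⟩
  rw [Nat.add_sub_cancel]
  rw [pow_succ', mul_assoc] at hmain
  refine (le_of_mul_le_mul_left hmain hk).trans ?_
  rw [Finset.sum_add_distrib, ← Finset.mul_sum, Finset.sum_const, Finset.card_range, nsmul_eq_mul]
  have hgeo : ∑ i ∈ Finset.range (n + 1), (1 - α * μc) ^ i ≤ 1 / (α * μc) := by
    have h := geom_sum_mul_neg (1 - α * μc) (n + 1)
    rw [le_div_iff₀ (by positivity)]
    have := pow_pos hk (n + 1)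
    have e : 1 - (1 - α * μc) = α * μc := by ring
    rw [e] at h
    linarith
  have hA : α * ρ * ‖w₁ - w₂‖ * ∑ i ∈ Finset.range (n + 1), (1 - α * μc) ^ i
      ≤ 2 * ρ / μc * ‖w₁ - w₂‖ := by
    refine (mul_le_mul_of_nonneg_left hgeo (by positivity)).trans ?_
    have e : α * ρ * ‖w₁ - w₂‖ * (1 / (α * μc)) = ρ / μc * ‖w₁ - w₂‖ := by field_simp
    have e2 : 2 * ρ / μc * ‖w₁ - w₂‖ = 2 * (ρ / μc * ‖w₁ - w₂‖) := by ring
    have : 0 ≤ ρ / μc * ‖w₁ - w₂‖ := by positivity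
    linarith
  have hB : ((n + 1 : ℕ) : ℝ) * (α * ρ * (L / μc + 1) * ‖φ₁ - φ₂‖)
      ≤ α * ρ * (2 * L / μc + 1) * ((n + 1 : ℕ) : ℝ) * ‖φ₁ - φ₂‖ := by
    have e2 : α * ρ * (2 * L / μc + 1) * ((n + 1 : ℕ) : ℝ) * ‖φ₁ - φ₂‖
      = ((n + 1 : ℕ) : ℝ) * (α * ρ * (L / μc + 1) * ‖φ₁ - φ₂‖)
        + ((n + 1 : ℕ) : ℝ) * (α * ρ * (L / μc) * ‖φ₁ - φ₂‖) := by ring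
    have : 0 ≤ ((n + 1 : ℕ) : ℝ) * (α * ρ * (L / μc) * ‖φ₁ - φ₂‖) := by positivity
    linarith
  refine (mul_le_mul_of_nonneg_left (add_le_add hA hB) (pow_pos hk n).le).trans (le_of_eq ?_)
  ring
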